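/- Let γ ≥ 0, ρ ∈ [0,1], τ > 0, and let Y be a countable set. Let (K, C) be a random pair on {0,1}^ℓ × {0,1}^n whose distribution is γ-close in statistical distance to uniform on {0,1}^{ℓ+n}. For each k ∈ {0,1}^ℓ, let f_k, g_k : {0,1}^n → Y be randomized functions such that for all k ∈ {0,1}^ℓ and all x* ∈ {0,1}^n, Pr[f_k(x) = g_k(x*)] ≤ τ, where x is uniform on {0,1}^n. Then Pr[f_K(C̃) = g_K(C)] ≤ τ^{(1/2)·(1−ρ²)/(1+ρ²)} + γ, where C̃ ← N_ρ(C) and f_K, g_K use independent internal randomness. -/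

import Mathlib

/-- The probability that the noise channel `N_ρ` maps `x` to `y`: each bit of `x` is kept
with probability `(1+ρ)/2` and flipped with probability `(1-ρ)/2`. -/
noncomputable def noiseK (ρ : ℝ) {n : ℕ} (x y : Fin n → Bool) : ℝ :=
  ∏ i, if y i = x i then (1 + ρ) / 2 else (1 - ρ) / 2

/-- The odd part of `(1 + u) ^ r`, for `r ∈ [0, 1]`, dominates its linear term. -/
lemma two_mul_mul_le_rpow_sub_rpow {r u : ℝ} (hr0 : 0 ≤ r) (hr1 : r ≤ 1)
    (hu0 : 0 ≤ u) (hu1 : u ≤ 1) : 2 * r * u ≤ (1 + u) ^ r - (1 - u) ^ r := by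
  have hmono : MonotoneOn (fun t : ℝ => (1 + t) ^ r - (1 - t) ^ r - 2 * r * t)
      (Set.Icc 0 1) := by
    apply monotoneOn_of_hasDerivWithinAt_nonneg (convex_Icc 0 1)
      (f' := fun t => r * ((1 + t) ^ (r - 1) + (1 - t) ^ (r - 1) - 2))
    · refine Continuous.continuousOn ?_
      refine ((Continuous.rpow_const (by fun_prop) fun _ => Or.inr hr0).sub
        (Continuous.rpow_const (by fun_prop) fun _ => Or.inr hr0)).sub (by fun_prop)
    · intro t ht
      rw [interior_Icc] at ht
      apply HasDerivAt.hasDerivWithinAt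
      have h1 := ((hasDerivAt_id t).const_add 1).rpow_const (p := r)
        (Or.inl (by simp only [id]; linarith [ht.1]))
      have h2 := ((hasDerivAt_id t).const_sub 1).rpow_const (p := r)
        (Or.inl (by simp only [id]; linarith [ht.2]))
      have h3 := (hasDerivAt_id t).const_mul (2 * r)
      refine ((h1.sub h2).sub h3).congr_deriv ?_
      simp only [id]
      ring
    · intro t ht
      rw [interior_Icc] at ht
      have ha : 0 < 1 + t := by linarith [ht.1]
      have hb : 0 < 1 - t := by linarith [ht.2]
      set A := (1 + t) ^ (r - 1) with hA
      set B := (1 - t) ^ (r - 1) with hB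
      have hA0 : 0 < A := Real.rpow_pos_of_pos ha _
      have hB0 : 0 < B := Real.rpow_pos_of_pos hb _
      have hAB : 1 ≤ A * B := by
        rw [hA, hB, ← Real.mul_rpow ha.le hb.le]
        exact Real.one_le_rpow_of_pos_of_le_one_of_nonpos (by positivity)
          (by nlinarith [sq_nonneg t]) (by linarith)
      have : 2 ≤ A + B := by nlinarith [sq_nonneg (A - B)]
      exact mul_nonneg hr0 (by linarith)
  have := hmono ⟨le_rfl, zero_le_one⟩ ⟨hu0, hu1⟩ hu0
  simp at this
  linarith

/-- The even part of `(1 + u) ^ (1 + r)`, for `r ∈ [0, 1]`, dominates its quadratic expansion. -/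
lemma two_add_mul_sq_le_rpow_add_rpow {r u : ℝ} (hr0 : 0 ≤ r) (hr1 : r ≤ 1)
    (hu0 : 0 ≤ u) (hu1 : u ≤ 1) :
    2 + (1 + r) * r * u ^ 2 ≤ (1 + u) ^ (1 + r) + (1 - u) ^ (1 + r) := by
  have hmono : MonotoneOn
      (fun t : ℝ => (1 + t) ^ (1 + r) + (1 - t) ^ (1 + r) - (1 + r) * r * t ^ 2)
      (Set.Icc 0 1) := by
    apply monotoneOn_of_hasDerivWithinAt_nonneg (convex_Icc 0 1)
      (f' := fun t => (1 + r) * ((1 + t) ^ r - (1 - t) ^ r - 2 * r * t))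
    · refine Continuous.continuousOn ?_
      refine ((Continuous.rpow_const (by fun_prop) fun _ => Or.inr (by linarith)).add
        (Continuous.rpow_const (by fun_prop) fun _ => Or.inr (by linarith))).sub (by fun_prop)
    · intro t ht
      rw [interior_Icc] at ht
      apply HasDerivAt.hasDerivWithinAt
      have h1 := ((hasDerivAt_id t).const_add 1).rpow_const (p := 1 + r)
        (Or.inl (by simp only [id]; linarith [ht.1]))
      have h2 := ((hasDerivAt_id t).const_sub 1).rpow_const (p := 1 + r)
        (Or.inl (by simp only [id]; linarith [ht.2]))
      have h3 := ((hasDerivAt_id t).pow 2).const_mul ((1 + r) * r)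
      refine ((h1.add h2).sub h3).congr_deriv ?_
      simp only [id, add_sub_cancel_left]
      push_cast
      ring
    · intro t ht
      rw [interior_Icc] at ht
      have := two_mul_mul_le_rpow_sub_rpow hr0 hr1 ht.1.le ht.2.le
      exact mul_nonneg (by linarith) (by linarith)
  have := hmono ⟨le_rfl, zero_le_one⟩ ⟨hu0, hu1⟩ hu0
  norm_num at this
  linarith

/-- The two-point hypercontractive inequality. -/
lemma sq_add_sq_le_rpow_mean {ρ a b : ℝ} (hρ : ρ ∈ Set.Icc (0 : ℝ) 1) (ha : 0 ≤ a)
    (hb : 0 ≤ b) :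
    ((a + b) / 2) ^ 2 + ρ ^ 2 * ((a - b) / 2) ^ 2
      ≤ (((a ^ (1 + ρ ^ 2) + b ^ (1 + ρ ^ 2)) / 2) ^ (1 / (1 + ρ ^ 2))) ^ 2 := by
  wlog hab : b ≤ a generalizing a b
  · have := this hb ha (le_of_not_ge hab)
    rw [add_comm (a ^ (1 + ρ ^ 2)), add_comm a]
    convert this using 2
    ring
  obtain ⟨h0, h1⟩ := hρ
  have hr0 : 0 ≤ ρ ^ 2 := by positivity
  have hr1 : ρ ^ 2 ≤ 1 := by nlinarith
  generalize ρ ^ 2 = r at *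
  rcases ha.eq_or_lt with rfl | ha
  · obtain rfl : b = 0 := le_antisymm hab hb
    simp
    positivity
  set m := (a + b) / 2 with hm
  have hm0 : 0 < m := by positivity
  obtain ⟨u, hu⟩ : ∃ u, u = (a - b) / 2 / m := ⟨_, rfl⟩
  have hum : (a - b) / 2 = m * u := by rw [hu]; field_simp
  have hu0 : 0 ≤ u := by rw [hu]; exact div_nonneg (by linarith) hm0.le
  have hu1 : u ≤ 1 := by rw [hu, div_le_one hm0]; linarith
  have ea : a = m * (1 + u) := by linarith
  have eb : b = m * (1 - u) := by linarith
  have hp : 0 < 1 + r := by linarith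
  have key : (1 + r * u ^ 2) ^ ((1 + r) / 2)
      ≤ ((1 + u) ^ (1 + r) + (1 - u) ^ (1 + r)) / 2 := by
    have := two_add_mul_sq_le_rpow_add_rpow hr0 hr1 hu0 hu1
    have h2 := rpow_one_add_le_one_add_mul_self (s := r * u ^ 2) (p := (1 + r) / 2)
      (by nlinarith [sq_nonneg u]) (by linarith) (by linarith)
    linarith
  have hpos : 0 ≤ 1 + r * u ^ 2 := by positivity
  have key2 : 1 + r * u ^ 2
      ≤ ((((1 + u) ^ (1 + r) + (1 - u) ^ (1 + r)) / 2) ^ (1 / (1 + r))) ^ 2 := by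
    calc 1 + r * u ^ 2 = (((1 + r * u ^ 2) ^ ((1 + r) / 2)) ^ (1 / (1 + r))) ^ 2 := by
          rw [← Real.rpow_mul hpos, ← Real.rpow_mul_natCast hpos,
            show (1 + r) / 2 * (1 / (1 + r)) * ((2 : ℕ) : ℝ) = 1 by push_cast; field_simp,
            Real.rpow_one]
      _ ≤ _ := by gcongr
  rw [hum]
  have e : (a ^ (1 + r) + b ^ (1 + r)) / 2
      = m ^ (1 + r) * (((1 + u) ^ (1 + r) + (1 - u) ^ (1 + r)) / 2) := by
    rw [ea, eb, Real.mul_rpow hm0.le (by linarith), Real.mul_rpow hm0.le (by linarith)]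
    ring
  have hw : 0 ≤ 1 - u := by linarith
  rw [e, Real.mul_rpow (by positivity) (by positivity), ← Real.rpow_mul hm0.le,
    mul_one_div_cancel hp.ne', Real.rpow_one]
  nlinarith [mul_le_mul_of_nonneg_left key2 (sq_nonneg m)]

/-- The two-function form of the two-point hypercontractive inequality. -/
lemma two_point_bilinear_le {ρ : ℝ} (hρ : ρ ∈ Set.Icc (0 : ℝ) 1) {a b c d : ℝ}
    (ha : 0 ≤ a) (hb : 0 ≤ b) :
    ((1 + ρ) / 2 * (a * c + b * d) + (1 - ρ) / 2 * (a * d + b * c)) / 2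
      ≤ ((a ^ (1 + ρ ^ 2) + b ^ (1 + ρ ^ 2)) / 2) ^ (1 / (1 + ρ ^ 2))
        * √((c ^ 2 + d ^ 2) / 2) := by
  have h := sq_add_sq_le_rpow_mean hρ ha hb
  set N := ((a ^ (1 + ρ ^ 2) + b ^ (1 + ρ ^ 2)) / 2) ^ (1 / (1 + ρ ^ 2)) with hN
  have hN0 : 0 ≤ N := by positivity
  refine le_of_sq_le_sq ?_ (by positivity)
  rw [mul_pow, Real.sq_sqrt (by positivity)]
  refine le_trans ?_ (mul_le_mul_of_nonneg_right h (by positivity))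
  nlinarith [sq_nonneg (((1 + ρ) / 2 * a + (1 - ρ) / 2 * b) * d
    - ((1 - ρ) / 2 * a + (1 + ρ) / 2 * b) * c)]

lemma noiseK_nonneg {ρ : ℝ} (hρ : ρ ∈ Set.Icc (0 : ℝ) 1) {n : ℕ} (x y : Fin n → Bool) :
    0 ≤ noiseK ρ x y := by
  obtain ⟨h0, h1⟩ := hρ
  refine Finset.prod_nonneg fun i _ => ?_
  split_ifs <;> linarith

lemma noiseK_sum (ρ : ℝ) {n : ℕ} (x : Fin n → Bool) : ∑ y, noiseK ρ x y = 1 := by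
  unfold noiseK
  rw [← Fintype.prod_sum
    (fun i (b : Bool) => if b = x i then (1 + ρ) / 2 else (1 - ρ) / 2)]
  refine Finset.prod_eq_one fun i _ => ?_
  cases x i <;> simp <;> ring

lemma noiseK_cons (ρ : ℝ) {n : ℕ} (a b : Bool) (x y : Fin n → Bool) :
    noiseK ρ (Fin.cons a x : Fin (n + 1) → Bool) (Fin.cons b y)
      = (if b = a then (1 + ρ) / 2 else (1 - ρ) / 2) * noiseK ρ x y := by
  simp [noiseK, Fin.prod_univ_succ]

lemma sum_cube_succ {n : ℕ} (F : (Fin (n + 1) → Bool) → ℝ) :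
    ∑ x, F x = ∑ x : Fin n → Bool, F (Fin.cons true x)
      + ∑ x : Fin n → Bool, F (Fin.cons false x) := by
  rw [← (Fin.consEquiv fun _ : Fin (n + 1) => Bool).sum_comp, Fintype.sum_prod_type]
  simp [Fin.consEquiv]

/-- The two-function hypercontractive inequality on the discrete cube. -/
lemma noiseK_bilinear_le {ρ : ℝ} (hρ : ρ ∈ Set.Icc (0 : ℝ) 1) {n : ℕ}
    (f g : (Fin n → Bool) → ℝ) (hf : ∀ x, 0 ≤ f x) :
    (2 ^ n : ℝ)⁻¹ * ∑ x, ∑ y, noiseK ρ x y * (f y * g x)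
      ≤ ((2 ^ n : ℝ)⁻¹ * ∑ x, f x ^ (1 + ρ ^ 2)) ^ (1 / (1 + ρ ^ 2))
        * √((2 ^ n : ℝ)⁻¹ * ∑ x, g x ^ 2) := by
  have hp : (0 : ℝ) < 1 + ρ ^ 2 := by positivity
  induction n with
  | zero =>
    simp only [Fintype.sum_unique, pow_zero, inv_one, one_mul]
    rw [← Real.rpow_mul (hf _), mul_one_div_cancel hp.ne', Real.rpow_one, Real.sqrt_sq_eq_abs]
    simp only [noiseK, Finset.univ_eq_empty, Finset.prod_empty, one_mul]
    exact mul_le_mul_of_nonneg_left (le_abs_self _) (hf _)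
  | succ n ih =>
    let F : Bool → ℝ := fun b =>
      ((2 ^ n : ℝ)⁻¹ * ∑ x, f (Fin.cons b x) ^ (1 + ρ ^ 2)) ^ (1 / (1 + ρ ^ 2))
    let G : Bool → ℝ := fun b => √((2 ^ n : ℝ)⁻¹ * ∑ x, g (Fin.cons b x) ^ 2)
    have hS : ∀ b, 0 ≤ (2 ^ n : ℝ)⁻¹ * ∑ x, f (Fin.cons b x) ^ (1 + ρ ^ 2) := fun b =>
      mul_nonneg (by positivity)
        (Finset.sum_nonneg fun x _ => Real.rpow_nonneg (hf _) _)
    have hF0 : ∀ b, 0 ≤ F b := fun b => Real.rpow_nonneg (hS b) _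
    have hFp : ∀ b, F b ^ (1 + ρ ^ 2)
        = (2 ^ n : ℝ)⁻¹ * ∑ x, f (Fin.cons b x) ^ (1 + ρ ^ 2) := fun b => by
      rw [← Real.rpow_mul (hS b), one_div_mul_cancel hp.ne', Real.rpow_one]
    have hG2 : ∀ b, G b ^ 2 = (2 ^ n : ℝ)⁻¹ * ∑ x, g (Fin.cons b x) ^ 2 := fun b =>
      Real.sq_sqrt (by positivity)
    have hI : ∀ a b, (2 ^ n : ℝ)⁻¹ * ∑ x, ∑ y, noiseK ρ x y *
        (f (Fin.cons b y) * g (Fin.cons a x)) ≤ F b * G a := fun a b =>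
      ih (fun y => f (Fin.cons b y)) (fun x => g (Fin.cons a x)) fun _ => hf _
    have key := two_point_bilinear_le hρ (c := G true) (d := G false)
      (hF0 true) (hF0 false)
    rw [hFp, hFp, hG2, hG2] at key
    have e1 : (2 ^ (n + 1) : ℝ)⁻¹ * ∑ x, f x ^ (1 + ρ ^ 2)
        = ((2 ^ n : ℝ)⁻¹ * ∑ x, f (Fin.cons true x) ^ (1 + ρ ^ 2)
          + (2 ^ n : ℝ)⁻¹ * ∑ x, f (Fin.cons false x) ^ (1 + ρ ^ 2)) / 2 := by
      rw [sum_cube_succ, pow_succ, mul_inv]; ring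
    have e2 : (2 ^ (n + 1) : ℝ)⁻¹ * ∑ x, g x ^ 2
        = ((2 ^ n : ℝ)⁻¹ * ∑ x, g (Fin.cons true x) ^ 2
          + (2 ^ n : ℝ)⁻¹ * ∑ x, g (Fin.cons false x) ^ 2) / 2 := by
      rw [sum_cube_succ, pow_succ, mul_inv]; ring
    rw [e1, e2]
    refine le_trans ?_ key
    have hc1 : 0 ≤ (1 + ρ) / 2 := by linarith [hρ.1]
    have hc2 : 0 ≤ (1 - ρ) / 2 := by linarith [hρ.2]
    have htt := mul_le_mul_of_nonneg_left (hI true true) hc1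
    have hff := mul_le_mul_of_nonneg_left (hI false false) hc1
    have htf := mul_le_mul_of_nonneg_left (hI true false) hc2
    have hft := mul_le_mul_of_nonneg_left (hI false true) hc2
    have e3 : (2 ^ (n + 1) : ℝ)⁻¹ * ∑ x, ∑ y, noiseK ρ x y * (f y * g x)
        = ((1 + ρ) / 2 * ((2 ^ n : ℝ)⁻¹ * ∑ x, ∑ y, noiseK ρ x y *
            (f (Fin.cons true y) * g (Fin.cons true x)))
          + (1 + ρ) / 2 * ((2 ^ n : ℝ)⁻¹ * ∑ x, ∑ y, noiseK ρ x y *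
            (f (Fin.cons false y) * g (Fin.cons false x)))
          + (1 - ρ) / 2 * ((2 ^ n : ℝ)⁻¹ * ∑ x, ∑ y, noiseK ρ x y *
            (f (Fin.cons false y) * g (Fin.cons true x)))
          + (1 - ρ) / 2 * ((2 ^ n : ℝ)⁻¹ * ∑ x, ∑ y, noiseK ρ x y *
            (f (Fin.cons true y) * g (Fin.cons false x)))) / 2 := by
      rw [sum_cube_succ]
      simp only [sum_cube_succ, noiseK_cons, if_true, reduceCtorEq, if_false,
        Finset.sum_add_distrib, mul_assoc, ← Finset.mul_sum]
      rw [pow_succ, mul_inv]; ring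
    rw [e3]
    linarith

/-- Collision bound for noise-correlated uniform inputs. -/
lemma collision_bound_uniform {n : ℕ} {Y : Type*} {ρ : ℝ} (hρ : ρ ∈ Set.Icc (0 : ℝ) 1)
    {τ : ℝ} (hτ : 0 < τ) (p q : (Fin n → Bool) → Y → ℝ)
    (hp0 : ∀ x y, 0 ≤ p x y) (hp : ∀ x, HasSum (p x) 1)
    (hq0 : ∀ x y, 0 ≤ q x y) (hq : ∀ x, HasSum (q x) 1)
    (hpq : ∀ x x', Summable fun y => p x y * q x' y)
    (hcol : ∀ xs, ∑ x, (2 ^ n : ℝ)⁻¹ * ∑' y, p x y * q xs y ≤ τ) :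
    (2 ^ n : ℝ)⁻¹ * ∑ x, ∑ ct, noiseK ρ x ct * ∑' y, p ct y * q x y
      ≤ τ ^ ((1 / 2) * ((1 - ρ ^ 2) / (1 + ρ ^ 2))) := by
  have hr0 : 0 ≤ ρ ^ 2 := sq_nonneg ρ
  have hr1 : ρ ^ 2 ≤ 1 := by nlinarith [hρ.1, hρ.2]
  have hcard : (2 ^ n : ℝ)⁻¹ * ∑ _x : Fin n → Bool, (1 : ℝ) = 1 := by
    simp
  have hp1 : ∀ x y, p x y ≤ 1 := fun x y => le_hasSum (hp x) y fun z _ => hp0 x z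
  have hq1 : ∀ x y, q x y ≤ 1 := fun x y => le_hasSum (hq x) y fun z _ => hq0 x z
  set s := (1 / 2) * ((1 - ρ ^ 2) / (1 + ρ ^ 2)) with hs
  have hs0 : 0 ≤ s := by
    have : 0 ≤ 1 - ρ ^ 2 := by linarith
    positivity
  have hs1 : s ≤ 1 / 2 := by
    have : (1 - ρ ^ 2) / (1 + ρ ^ 2) ≤ 1 := by
      rw [div_le_one (by positivity)]; linarith
    linarith
  have hsp : 1 / (1 + ρ ^ 2) = 1 / 2 + s := by rw [hs]; field_simp; ring
  let a : Y → ℝ := fun y => (2 ^ n : ℝ)⁻¹ * ∑ x, p x y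
  let b : Y → ℝ := fun y => (2 ^ n : ℝ)⁻¹ * ∑ x, q x y
  have ha0 : ∀ y, 0 ≤ a y := fun y =>
    mul_nonneg (by positivity) (Finset.sum_nonneg fun x _ => hp0 x y)
  have hb0 : ∀ y, 0 ≤ b y := fun y =>
    mul_nonneg (by positivity) (Finset.sum_nonneg fun x _ => hq0 x y)
  have hA : HasSum a 1 := by
    rw [← hcard]; exact (hasSum_sum fun x _ => hp x).mul_left _
  have hB : HasSum b 1 := by
    rw [← hcard]; exact (hasSum_sum fun x _ => hq x).mul_left _
  obtain ⟨S, hAB, hSτ⟩ : ∃ S, HasSum (fun y => a y * b y) S ∧ S ≤ τ := by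
    refine ⟨(2 ^ n : ℝ)⁻¹ * ∑ xs, ∑ x, (2 ^ n : ℝ)⁻¹ * ∑' y, p x y * q xs y, ?_, ?_⟩
    · have := (hasSum_sum (s := Finset.univ) fun (xs : Fin n → Bool) _ =>
        hasSum_sum (s := Finset.univ) fun (x : Fin n → Bool) _ =>
          (hpq x xs).hasSum.mul_left (2 ^ n : ℝ)⁻¹).mul_left (2 ^ n : ℝ)⁻¹
      refine this.congr_fun ?_
      intro y
      simp only [a, b, ← Finset.mul_sum, ← Finset.sum_mul]
      ring
    · calc _ ≤ (2 ^ n : ℝ)⁻¹ * ∑ _xs : Fin n → Bool, τ := by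
            gcongr with xs; exact hcol xs
        _ = τ := by
            rw [← mul_one τ, ← Finset.mul_sum, mul_left_comm, hcard]
  have hL : HasSum (fun y => (2 ^ n : ℝ)⁻¹ * ∑ x, ∑ ct, noiseK ρ x ct * (p ct y * q x y))
      ((2 ^ n : ℝ)⁻¹ * ∑ x, ∑ ct, noiseK ρ x ct * ∑' y, p ct y * q x y) :=
    (hasSum_sum fun x _ => hasSum_sum fun ct _ =>
      (hpq ct x).hasSum.mul_left _).mul_left _
  have hR := ((hAB.mul_left (s / τ)).add ((hA.mul_left (1 / 2)).add
    (hB.mul_left (1 / 2 - s)))).mul_left (τ ^ s)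
  refine (hasSum_le (fun y => ?_) hL hR).trans ?_
  · have h1 := noiseK_bilinear_le hρ (fun x => p x y) (fun x => q x y) fun x => hp0 x y
    refine h1.trans ?_
    have h2 : (2 ^ n : ℝ)⁻¹ * ∑ x, p x y ^ (1 + ρ ^ 2) ≤ a y := by
      refine mul_le_mul_of_nonneg_left (Finset.sum_le_sum fun x _ => ?_) (by positivity)
      exact Real.rpow_le_self_of_le_one (hp0 x y) (hp1 x y) (by linarith)
    have h3 : (2 ^ n : ℝ)⁻¹ * ∑ x, q x y ^ 2 ≤ b y := by
      refine mul_le_mul_of_nonneg_left (Finset.sum_le_sum fun x _ => ?_) (by positivity)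
      nlinarith [hq0 x y, hq1 x y]
    have h4 : 0 ≤ (2 ^ n : ℝ)⁻¹ * ∑ x, p x y ^ (1 + ρ ^ 2) :=
      mul_nonneg (by positivity) (Finset.sum_nonneg fun x _ => Real.rpow_nonneg (hp0 x y) _)
    have h5 := mul_le_mul (Real.rpow_le_rpow h4 h2 (by positivity : 0 ≤ 1 / (1 + ρ ^ 2)))
      (Real.sqrt_le_sqrt h3) (Real.sqrt_nonneg _) (Real.rpow_nonneg (ha0 y) _)
    refine h5.trans ?_
    rw [hsp, Real.sqrt_eq_rpow]
    have h6 := Real.geom_mean_le_arith_mean3_weighted hs0 (by norm_num : (0 : ℝ) ≤ 1 / 2)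
      (by linarith : 0 ≤ 1 / 2 - s) (div_nonneg (mul_nonneg (ha0 y) (hb0 y)) hτ.le)
      (ha0 y) (hb0 y) (by ring)
    have h7 : a y ^ (1 / 2 + s) * b y ^ (1 / 2 : ℝ)
        = τ ^ s * ((a y * b y / τ) ^ s * a y ^ (1 / 2 : ℝ) * b y ^ (1 / 2 - s)) := by
      have hτs : τ ^ s ≠ 0 := (Real.rpow_pos_of_pos hτ s).ne'
      rw [Real.div_rpow (mul_nonneg (ha0 y) (hb0 y)) hτ.le,
        Real.mul_rpow (ha0 y) (hb0 y), Real.rpow_add_of_nonneg (ha0 y) (by norm_num) hs0]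
      have hb2 : b y ^ (1 / 2 : ℝ) = b y ^ s * b y ^ (1 / 2 - s) := by
        rw [← Real.rpow_add_of_nonneg (hb0 y) hs0 (by linarith)]
        congr 1; ring
      rw [hb2]
      field_simp
    rw [h7]
    refine mul_le_mul_of_nonneg_left (h6.trans (le_of_eq ?_)) (Real.rpow_nonneg hτ.le _)
    ring
  · refine mul_le_of_le_one_right (Real.rpow_nonneg hτ.le _) ?_
    have : s / τ * S ≤ s := by
      rw [div_mul_eq_mul_div, div_le_iff₀ hτ]
      exact mul_le_mul_of_nonneg_left hSτ hs0
    linarith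

/-- Expectations of `[0, 1]`-valued functions differ by at most the statistical distance. -/
lemma sum_mul_le_sum_mul_add_half_sum_abs_sub {ι : Type*} [Fintype ι] (μ ν h : ι → ℝ)
    (hμν : ∑ i, μ i = ∑ i, ν i) (h0 : ∀ i, 0 ≤ h i) (h1 : ∀ i, h i ≤ 1) :
    ∑ i, μ i * h i ≤ ∑ i, ν i * h i + (1 / 2) * ∑ i, |μ i - ν i| := by
  have key : ∑ i, (μ i - ν i) * (h i - 1 / 2) ≤ ∑ i, (1 / 2) * |μ i - ν i| := by
    refine Finset.sum_le_sum fun i _ => (le_abs_self _).trans ?_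
    rw [abs_mul, mul_comm]
    refine mul_le_mul_of_nonneg_right ?_ (abs_nonneg _)
    rw [abs_le]
    constructor <;> linarith [h0 i, h1 i]
  simp only [sub_mul, mul_sub, Finset.sum_sub_distrib, ← Finset.sum_mul,
    ← Finset.mul_sum] at key
  linarith

/-- Let `γ ≥ 0`, `ρ ∈ [0,1]`, `τ > 0`, and let `Y` be a countable set.
Let `(K, C)` be a random pair on `{0,1}^ℓ × {0,1}^n` (with joint mass function `μ`)
whose distribution is `γ`-close in statistical distance to uniform on `{0,1}^{ℓ+n}`.
For each `k`, let `f_k, g_k : {0,1}^n → Y` be randomized functions (with kernels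
`p k`, `q k`) such that for all `k` and all `x*`, `Pr[f_k(x) = g_k(x*)] ≤ τ` over
uniform `x`.  Then `Pr[f_K(C̃) = g_K(C)] ≤ τ^{(1/2)·(1−ρ²)/(1+ρ²)} + γ`, where
`C̃ ← N_ρ(C)` and `f_K, g_K` use independent internal randomness. -/
theorem collision_bound_near_uniform {l n : ℕ} {Y : Type*} [Countable Y]
    (γ : ℝ) (hγ : 0 ≤ γ) (ρ : ℝ) (hρ : ρ ∈ Set.Icc (0 : ℝ) 1) (τ : ℝ) (hτ : 0 < τ)
    (μ : (Fin l → Bool) × (Fin n → Bool) → ℝ)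
    (hμ0 : ∀ kc, 0 ≤ μ kc) (hμ1 : ∑ kc, μ kc = 1)
    (hclose : (1 / 2) * ∑ kc, |μ kc - (2 ^ (l + n) : ℝ)⁻¹| ≤ γ)
    (p q : (Fin l → Bool) → (Fin n → Bool) → Y → ℝ)
    (hp0 : ∀ k x y, 0 ≤ p k x y) (hp1 : ∀ k x, ∑' y, p k x y = 1)
    (hq0 : ∀ k x y, 0 ≤ q k x y) (hq1 : ∀ k x, ∑' y, q k x y = 1)
    (hcol : ∀ k (xs : Fin n → Bool),
      ∑ x, (2 ^ n : ℝ)⁻¹ * ∑' y, p k x y * q k xs y ≤ τ) :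
    ∑ kc : (Fin l → Bool) × (Fin n → Bool),
        μ kc * ∑ ct, noiseK ρ kc.2 ct * ∑' y, p kc.1 ct y * q kc.1 kc.2 y
      ≤ τ ^ ((1 / 2) * ((1 - ρ ^ 2) / (1 + ρ ^ 2))) + γ := by
  have hpS : ∀ k x, HasSum (p k x) 1 := fun k x => by
    rw [← hp1 k x]
    exact (by_contra fun h => by simpa [tsum_eq_zero_of_not_summable h] using hp1 k x :
      Summable (p k x)).hasSum
  have hqS : ∀ k x, HasSum (q k x) 1 := fun k x => by
    rw [← hq1 k x]
    exact (by_contra fun h => by simpa [tsum_eq_zero_of_not_summable h] using hq1 k x :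
      Summable (q k x)).hasSum
  have hle : ∀ k x x' y, p k x y * q k x' y ≤ p k x y := fun k x x' y =>
    mul_le_of_le_one_right (hp0 k x y) (le_hasSum (hqS k x') y fun z _ => hq0 k x' z)
  have hpq : ∀ k x x', Summable fun y => p k x y * q k x' y := fun k x x' =>
    Summable.of_nonneg_of_le (fun y => mul_nonneg (hp0 k x y) (hq0 k x' y))
      (hle k x x') (hpS k x).summable
  have hcoll1 : ∀ k x x', ∑' y, p k x y * q k x' y ≤ 1 := fun k x x' => by
    rw [← hp1 k x]
    exact (hpq k x x').tsum_le_tsum (hle k x x') (hpS k x).summable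
  have hsd := sum_mul_le_sum_mul_add_half_sum_abs_sub μ (fun _ => (2 ^ (l + n) : ℝ)⁻¹)
    (fun kc => ∑ ct, noiseK ρ kc.2 ct * ∑' y, p kc.1 ct y * q kc.1 kc.2 y)
    (by rw [hμ1]; simp [pow_add]; field_simp)
    (fun kc => Finset.sum_nonneg fun ct _ => mul_nonneg (noiseK_nonneg hρ _ _)
      (tsum_nonneg fun y => mul_nonneg (hp0 _ _ y) (hq0 _ _ y)))
    (fun kc => by
      rw [← noiseK_sum ρ kc.2]
      exact Finset.sum_le_sum fun ct _ =>
        mul_le_of_le_one_right (noiseK_nonneg hρ _ _) (hcoll1 _ _ _))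
  refine hsd.trans (add_le_add ?_ hclose)
  rw [Fintype.sum_prod_type]
  calc _ = (2 ^ l : ℝ)⁻¹ * ∑ k, ((2 ^ n : ℝ)⁻¹ * ∑ x, ∑ ct, noiseK ρ x ct *
        ∑' y, p k ct y * q k x y) := by
        simp only [← Finset.mul_sum, pow_add, mul_inv, mul_assoc]
    _ ≤ (2 ^ l : ℝ)⁻¹ * ∑ _k : Fin l → Bool,
        τ ^ ((1 / 2) * ((1 - ρ ^ 2) / (1 + ρ ^ 2))) := by
        gcongr with k
        exact collision_bound_uniform hρ hτ (p k) (q k) (hp0 k) (hpS k) (hq0 k) (hqS k)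
          (hpq k) (hcol k)
    _ = _ := by simp
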